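/- arXiv:math/9812076 — 3 statements merged into one kernel-verified Lean document; each statement's English description precedes it below -/
import Mathlib

section
/- Let G₃ be the group with underlying set ℂ³ and multiplication (a₁,b₁,c₁)·(a₂,b₂,c₂) = (a₁+a₂, e^{a₁}b₂+b₁+a₁e^{a₁}c₂, e^{a₁}c₂+c₁). The commutator subgroup of G₃ equals {(0, b, c) : b, c ∈ ℂ}; in particular, it is an abelian normal subgroup. -/
/-- The group `G₃`: underlying set `ℂ³` with multiplication
`(a₁,b₁,c₁)·(a₂,b₂,c₂) = (a₁+a₂, e^{a₁}b₂+b₁+a₁e^{a₁}c₂, e^{a₁}c₂+c₁)`. -/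
@[ext]
structure GroupG3 where
  a : ℂ
  b : ℂ
  c : ℂ

namespace GroupG3

noncomputable instance : Mul GroupG3 :=
  ⟨fun g h => ⟨g.a + h.a,
    Complex.exp g.a * h.b + g.b + g.a * Complex.exp g.a * h.c,
    Complex.exp g.a * h.c + g.c⟩⟩

instance : One GroupG3 := ⟨⟨0, 0, 0⟩⟩

noncomputable instance : Inv GroupG3 :=
  ⟨fun g => ⟨-g.a,
    -(Complex.exp (-g.a) * g.b) + g.a * Complex.exp (-g.a) * g.c,
    -(Complex.exp (-g.a) * g.c)⟩⟩

@[simp] lemma mul_a (g h : GroupG3) : (g * h).a = g.a + h.a := rfl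
@[simp] lemma mul_b (g h : GroupG3) :
    (g * h).b = Complex.exp g.a * h.b + g.b + g.a * Complex.exp g.a * h.c := rfl
@[simp] lemma mul_c (g h : GroupG3) : (g * h).c = Complex.exp g.a * h.c + g.c := rfl
@[simp] lemma one_a : (1 : GroupG3).a = 0 := rfl
@[simp] lemma one_b : (1 : GroupG3).b = 0 := rfl
@[simp] lemma one_c : (1 : GroupG3).c = 0 := rfl
@[simp] lemma inv_a (g : GroupG3) : (g⁻¹).a = -g.a := rfl
@[simp] lemma inv_b (g : GroupG3) :
    (g⁻¹).b = -(Complex.exp (-g.a) * g.b) + g.a * Complex.exp (-g.a) * g.c := rfl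
@[simp] lemma inv_c (g : GroupG3) : (g⁻¹).c = -(Complex.exp (-g.a) * g.c) := rfl

noncomputable instance : Group GroupG3 where
  mul_assoc g h k := by ext <;> simp [Complex.exp_add] <;> ring
  one_mul g := by ext <;> simp
  mul_one g := by ext <;> simp
  inv_mul_cancel g := by ext <;> simp <;> ring

end GroupG3

namespace GroupG3

/-- The projection of `G₃` onto its first coordinate, as a homomorphism to `(ℂ, +)`. -/
def aHom : GroupG3 →* Multiplicative ℂ where
  toFun g := Multiplicative.ofAdd g.a
  map_one' := rfl
  map_mul' _ _ := rfl

lemma a_eq_zero_of_mem_commutator {g : GroupG3} (hg : g ∈ commutator GroupG3) : g.a = 0 :=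
  congrArg Multiplicative.toAdd (Abelianization.commutator_subset_ker aHom hg)

open scoped commutatorElement in
lemma mem_commutator_of_a_eq_zero {g : GroupG3} (hg : g.a = 0) : g ∈ commutator GroupG3 := by
  have hexp : Complex.exp (Complex.log 2) = 2 := Complex.exp_log two_ne_zero
  have key : g = ⁅(⟨Complex.log 2, 0, 0⟩ : GroupG3),
      (⟨0, g.b - 2 * Complex.log 2 * g.c, g.c⟩ : GroupG3)⁆ := by
    rw [commutatorElement_def]
    ext
    · simp [hg]
    · simp [hexp]
      ring
    · simp [hexp]
      ring
  rw [key, commutator_def]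
  exact Subgroup.commutator_mem_commutator (Subgroup.mem_top _) (Subgroup.mem_top _)

lemma mem_commutator_iff {g : GroupG3} : g ∈ commutator GroupG3 ↔ g.a = 0 :=
  ⟨a_eq_zero_of_mem_commutator, mem_commutator_of_a_eq_zero⟩

lemma mul_comm_of_a_eq_zero {x y : GroupG3} (hx : x.a = 0) (hy : y.a = 0) : x * y = y * x := by
  ext <;> simp [hx, hy, add_comm]

end GroupG3

/-- The commutator subgroup of `G₃` equals `{(0,b,c) : b, c ∈ ℂ}`;
in particular it is an abelian normal subgroup. -/
theorem groupG3_commutator :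
    ((commutator GroupG3 : Subgroup GroupG3) : Set GroupG3) =
        {g : GroupG3 | g.a = 0} ∧
    (∀ x ∈ commutator GroupG3, ∀ y ∈ commutator GroupG3, x * y = y * x) ∧
    (commutator GroupG3).Normal := by
  refine ⟨Set.ext fun _ => GroupG3.mem_commutator_iff, fun x hx y hy => ?_, inferInstance⟩
  exact GroupG3.mul_comm_of_a_eq_zero (GroupG3.mem_commutator_iff.1 hx)
    (GroupG3.mem_commutator_iff.1 hy)
end

section
/- Let a, b, c be positive natural numbers and let the multiplicative group ℂˣ act on ℂ³ by λ·(x,y,z) = (λᵃx, λᵇy, λ⁻ᶜz). Let S ⊆ ℂ³ be a closed subset (in the Euclidean topology) which is invariant under this action, and suppose there exists a point p ∈ S with third coordinate 0 such that p lies in the closure of {q ∈ S : the third coordinate of q is nonzero}. Then the whole axis {(0,0,t) : t ∈ ℂ} is contained in S. -/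
open Filter Topology

theorem tendsto_zero_of_tendsto_pow_zero {α : Type*} {F : Filter α} {f : α → ℂ} {c : ℕ}
    (h : Tendsto (fun x => f x ^ c) F (𝓝 0)) : Tendsto f F (𝓝 0) := by
  rw [Metric.tendsto_nhds] at h ⊢
  intro ε hε
  filter_upwards [h (ε ^ c) (pow_pos hε c)] with x hx
  rw [dist_zero_right, norm_pow] at hx
  rw [dist_zero_right]
  exact lt_of_pow_lt_pow_left₀ c hε.le hx

/-- Let `a, b, c` be positive natural numbers and let `ℂˣ` act on `ℂ³` by
`λ·(x,y,z) = (λᵃx, λᵇy, λ⁻ᶜz)`.  If `S ⊆ ℂ³` is a closed set invariant under this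
action and there is a point `p ∈ S` with third coordinate `0` lying in the closure of
`{q ∈ S : third coordinate of q is nonzero}`, then the axis `{(0,0,t) : t ∈ ℂ}` is
contained in `S`. -/
theorem axis_in_invariant_closed_set
    (a b c : ℕ) (ha : 0 < a) (hb : 0 < b) (hc : 0 < c)
    (S : Set (ℂ × ℂ × ℂ)) (hS : IsClosed S)
    (hinv : ∀ (l : ℂˣ) (p : ℂ × ℂ × ℂ), p ∈ S →
      ((l : ℂ) ^ a * p.1, (l : ℂ) ^ b * p.2.1, ((l : ℂ) ^ c)⁻¹ * p.2.2) ∈ S)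
    (p : ℂ × ℂ × ℂ) (hp : p ∈ S) (hp3 : p.2.2 = 0)
    (hcl : p ∈ closure {q ∈ S | q.2.2 ≠ 0}) :
    ∀ t : ℂ, ((0 : ℂ), (0 : ℂ), t) ∈ S := by
  obtain ⟨q, hq, hqp⟩ := mem_closure_iff_seq_limit.mp hcl
  have hx : Tendsto (fun n => (q n).1) atTop (𝓝 p.1) := (continuous_fst.tendsto p).comp hqp
  have hy : Tendsto (fun n => (q n).2.1) atTop (𝓝 p.2.1) :=
    ((continuous_fst.comp continuous_snd).tendsto p).comp hqp
  have hz : Tendsto (fun n => (q n).2.2) atTop (𝓝 0) :=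
    hp3 ▸ ((continuous_snd.comp continuous_snd).tendsto p).comp hqp
  have hne : ∀ t : ℂ, t ≠ 0 → ((0 : ℂ), (0 : ℂ), t) ∈ S := by
    intro t ht
    choose l hl using fun n => IsAlgClosed.exists_pow_nat_eq ((q n).2.2 / t) hc
    have hl0 (n : ℕ) : l n ≠ 0 := by
      intro h
      have := hl n
      rw [h, zero_pow hc.ne'] at this
      exact div_ne_zero (hq n).2 ht this.symm
    have hlim : Tendsto l atTop (𝓝 0) := by
      apply tendsto_zero_of_tendsto_pow_zero (c := c)
      simpa [hl] using hz.div_const t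
    have hmem (n : ℕ) : (l n ^ a * (q n).1, l n ^ b * (q n).2.1, t) ∈ S := by
      have h := hinv (Units.mk0 (l n) (hl0 n)) (q n) (hq n).1
      have hzn : (q n).2.2 ≠ 0 := (hq n).2
      have ht' : ((q n).2.2 / t)⁻¹ * (q n).2.2 = t := by field_simp
      rwa [Units.val_mk0, hl, ht'] at h
    refine hS.mem_of_tendsto (b := atTop)
      (Tendsto.prodMk_nhds ?_ (Tendsto.prodMk_nhds ?_ tendsto_const_nhds))
      (Eventually.of_forall hmem)
    · simpa [ha.ne'] using (hlim.pow a).mul hx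
    · simpa [hb.ne'] using (hlim.pow b).mul hy
  intro t
  have hcont : Continuous fun s : ℂ => ((0 : ℂ), (0 : ℂ), s) := by fun_prop
  have hsub : closure {(0 : ℂ)}ᶜ ⊆ (fun s : ℂ => ((0 : ℂ), (0 : ℂ), s)) ⁻¹' S :=
    closure_minimal hne (hS.preimage hcont)
  exact hsub (dense_compl_singleton (0 : ℂ) t)
end

section
/- Let n be a positive natural number and let ι : ℂˣ → GL(n, ℂ) be a group homomorphism from the multiplicative group of nonzero complex numbers to the group of invertible n×n complex matrices such that every matrix entry of ι, viewed as a function on ℂ ∖ {0}, is holomorphic. Then the range of ι is a closed subset of GL(n, ℂ). -/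
open Filter Topology Matrix

/-- A nonzero endomorphism over an algebraically closed field has a nonzero eigenvalue or a Jordan
chain of length two for the eigenvalue zero. -/
theorem exists_ne_zero_eigenvector_or_jordan_chain {K V : Type*} [Field K] [IsAlgClosed K]
    [AddCommGroup V] [Module K V] [FiniteDimensional K V] {f : Module.End K V} (hf : f ≠ 0) :
    (∃ μ : K, μ ≠ 0 ∧ ∃ v : V, v ≠ 0 ∧ f v = μ • v) ∨ ∃ v : V, f v ≠ 0 ∧ f (f v) = 0 := by
  have hW : Nontrivial (LinearMap.range f) := by
    rw [Submodule.nontrivial_iff_ne_bot]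
    exact fun h => hf (LinearMap.range_eq_bot.mp h)
  obtain ⟨μ, hμ⟩ := Module.End.exists_eigenvalue
    (f.restrict (p := LinearMap.range f) (q := LinearMap.range f) fun x _ => ⟨x, rfl⟩)
  obtain ⟨⟨_, v, rfl⟩, hv⟩ := hμ.exists_hasEigenvector
  have hv₀ : f v ≠ 0 := fun h => hv.2 (Subtype.ext h)
  have hv₁ : f (f v) = μ • f v := congrArg Subtype.val hv.apply_eq_smul
  by_cases h : μ = 0
  · exact Or.inr ⟨v, hv₀, by rw [hv₁, h, zero_smul]⟩
  · exact Or.inl ⟨μ, h, f v, hv₀, hv₁⟩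

section OneParameter

variable {n : Type*} [Fintype n] {F : ℂ → Matrix n n ℂ} {A : Matrix n n ℂ}

theorem hasDerivAt_mulVec_of_oneParameter (hadd : ∀ s t, F (s + t) = F s * F t)
    (hA : ∀ i j, HasDerivAt (fun t => F t i j) (A i j) 0) (v : n → ℂ) (t : ℂ) :
    HasDerivAt (fun s => F s *ᵥ v) (F t *ᵥ (A *ᵥ v)) t := by
  have key : ∀ i j, HasDerivAt (fun s => F s i j) ((F t * A) i j) t := by
    intro i j
    have h : HasDerivAt (fun s => ∑ k, F t i k * F (s - t) k j) (∑ k, F t i k * A k j) t := by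
      refine HasDerivAt.fun_sum fun k _ => HasDerivAt.const_mul _ ?_
      have h0 : HasDerivAt (fun s => F s k j) (A k j) (t - t) := by
        rw [sub_self]
        exact hA k j
      exact h0.comp_sub_const t t
    simpa only [← Matrix.mul_apply, ← hadd, add_sub_cancel] using h
  rw [hasDerivAt_pi]
  intro i
  rw [Matrix.mulVec_mulVec]
  exact HasDerivAt.fun_sum fun j _ => (key i j).mul_const (v j)

variable [DecidableEq n]

theorem mulVec_eq_exp_smul_of_oneParameter (h0 : F 0 = 1) (hadd : ∀ s t, F (s + t) = F s * F t)
    (hA : ∀ i j, HasDerivAt (fun t => F t i j) (A i j) 0) {μ : ℂ} {v : n → ℂ}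
    (hv : A *ᵥ v = μ • v) (t : ℂ) : F t *ᵥ v = Complex.exp (μ * t) • v := by
  have hd : ∀ s, HasDerivAt (fun s => Complex.exp (-(μ * s)) • (F s *ᵥ v)) 0 s := by
    intro s
    have h := (((hasDerivAt_id s).const_mul μ).fun_neg.cexp).fun_smul
      (hasDerivAt_mulVec_of_oneParameter hadd hA v s)
    refine h.congr_deriv ?_
    rw [hv, Matrix.mulVec_smul, smul_smul, ← add_smul]
    simp
  have hc := is_const_of_deriv_eq_zero (fun s => (hd s).differentiableAt) (fun s => (hd s).deriv) t 0
  simp only [mul_zero, neg_zero, Complex.exp_zero, h0, Matrix.one_mulVec, one_smul] at hc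
  calc F t *ᵥ v = Complex.exp (μ * t) • Complex.exp (-(μ * t)) • (F t *ᵥ v) := by
        rw [smul_smul, ← Complex.exp_add, add_neg_cancel, Complex.exp_zero, one_smul]
    _ = Complex.exp (μ * t) • v := by rw [hc]

theorem mulVec_eq_add_smul_of_oneParameter (h0 : F 0 = 1) (hadd : ∀ s t, F (s + t) = F s * F t)
    (hA : ∀ i j, HasDerivAt (fun t => F t i j) (A i j) 0) {v : n → ℂ}
    (hv : A *ᵥ (A *ᵥ v) = 0) (t : ℂ) : F t *ᵥ v = v + t • (A *ᵥ v) := by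
  have hw : ∀ s, F s *ᵥ (A *ᵥ v) = A *ᵥ v := fun s => by
    have h := mulVec_eq_exp_smul_of_oneParameter h0 hadd hA (μ := 0) (v := A *ᵥ v) (by simp [hv]) s
    simpa using h
  have hd : ∀ s, HasDerivAt (fun s => F s *ᵥ v - s • (A *ᵥ v)) 0 s := by
    intro s
    have h := (hasDerivAt_mulVec_of_oneParameter hadd hA v s).fun_sub
      ((hasDerivAt_id s).smul_const (A *ᵥ v))
    refine h.congr_deriv ?_
    rw [hw, one_smul, sub_self]
  have hc := is_const_of_deriv_eq_zero (fun s => (hd s).differentiableAt) (fun s => (hd s).deriv) t 0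
  simp only [h0, Matrix.one_mulVec, zero_smul, sub_zero] at hc
  exact sub_eq_iff_eq_add.mp hc

/-- A holomorphic one-parameter group of period `2πi` is trivial or acts on some nonzero vector by
a nontrivial integral character. -/
theorem eq_one_or_exists_eigenvector_of_periodic (h0 : F 0 = 1)
    (hadd : ∀ s t, F (s + t) = F s * F t)
    (hF : ∀ i j, DifferentiableAt ℂ (fun t => F t i j) 0)
    (hper : F (2 * Real.pi * Complex.I) = 1) :
    (∀ t, F t = 1) ∨
      ∃ k : ℤ, k ≠ 0 ∧ ∃ v : n → ℂ, v ≠ 0 ∧ ∀ t, F t *ᵥ v = Complex.exp t ^ k • v := by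
  obtain ⟨A, hA⟩ : ∃ A : Matrix n n ℂ, ∀ i j, HasDerivAt (fun t => F t i j) (A i j) 0 :=
    ⟨fun i j => deriv (fun t => F t i j) 0, fun i j => (hF i j).hasDerivAt⟩
  by_cases hA0 : A = 0
  · left
    intro t
    apply Matrix.ext_of_mulVec_single
    intro i
    have h := mulVec_eq_exp_smul_of_oneParameter h0 hadd hA (μ := 0) (v := Pi.single i 1)
      (by rw [hA0, Matrix.zero_mulVec, zero_smul]) t
    rwa [zero_mul, Complex.exp_zero, one_smul, ← Matrix.one_mulVec (Pi.single i 1),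
      Matrix.mulVec_mulVec, mul_one] at h
  · right
    rcases exists_ne_zero_eigenvector_or_jordan_chain
      (f := Matrix.toLin' A) (by simpa using hA0) with ⟨μ, hμ, v, hv, hAv⟩ | ⟨v, hv, hAv⟩
    · have hexp := mulVec_eq_exp_smul_of_oneParameter h0 hadd hA (by simpa using hAv)
      have h1 : Complex.exp (μ * (2 * Real.pi * Complex.I)) = 1 := by
        have h := hexp (2 * Real.pi * Complex.I)
        rw [hper, Matrix.one_mulVec] at h
        exact (smul_left_injective ℂ hv (by simpa using h)).symm
      obtain ⟨k, hk⟩ := Complex.exp_eq_one_iff.mp h1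
      obtain rfl : μ = k := mul_right_cancel₀ Complex.two_pi_I_ne_zero hk
      exact ⟨k, by exact_mod_cast hμ, v, hv, fun t => by rw [hexp, Complex.exp_int_mul]⟩
    · have h := mulVec_eq_add_smul_of_oneParameter h0 hadd hA (by simpa using hAv)
        (2 * Real.pi * Complex.I)
      rw [hper, Matrix.one_mulVec, left_eq_add, smul_eq_zero] at h
      exact absurd (h.resolve_left Complex.two_pi_I_ne_zero) (by simpa using hv)

end OneParameter

/-- If a nonzero integral power converges to a nonzero limit along an ultrafilter on `ℂˣ`, then the
ultrafilter itself converges in `ℂˣ`. -/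
theorem exists_le_nhds_of_tendsto_zpow {U : Ultrafilter ℂˣ} {k : ℤ} (hk : k ≠ 0) {c : ℂ}
    (hc : c ≠ 0) (h : Tendsto (fun u : ℂˣ => (u : ℂ) ^ k) U (𝓝 c)) :
    ∃ z : ℂˣ, (U : Filter ℂˣ) ≤ 𝓝 z := by
  have hk' : (k : ℝ) ≠ 0 := by exact_mod_cast hk
  have hnorm : Tendsto (fun u : ℂˣ => ‖(u : ℂ)‖) U (𝓝 (‖c‖ ^ (k : ℝ)⁻¹)) := by
    refine (h.norm.rpow_const (p := (k : ℝ)⁻¹) (Or.inl (norm_ne_zero_iff.mpr hc))).congr ?_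
    intro u
    rw [norm_zpow, ← Real.rpow_intCast, ← Real.rpow_mul (norm_nonneg _), mul_inv_cancel₀ hk',
      Real.rpow_one]
  have hball : ∀ᶠ u : ℂˣ in U, (u : ℂ) ∈ Metric.closedBall (0 : ℂ) (‖c‖ ^ (k : ℝ)⁻¹ + 1) := by
    filter_upwards [hnorm.eventually_le_const (lt_add_one _)] with u hu
    simpa using hu
  obtain ⟨z, -, hz⟩ := (isCompact_closedBall (0 : ℂ) (‖c‖ ^ (k : ℝ)⁻¹ + 1)).ultrafilter_le_nhds
    (U.map Units.val) (le_principal_iff.mpr hball)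
  have hz' : Tendsto (Units.val : ℂˣ → ℂ) U (𝓝 z) := hz
  have hz0 : z ≠ 0 := by
    rw [← norm_ne_zero_iff, tendsto_nhds_unique hz'.norm hnorm]
    exact (Real.rpow_pos_of_pos (norm_pos_iff.mpr hc) _).ne'
  refine ⟨Units.mk0 z hz0, ?_⟩
  rw [Units.isEmbedding_val₀.nhds_eq_comap, ← Filter.tendsto_iff_comap]
  exact hz'

/-- The image of a holomorphic group homomorphism `ℂ* → GL(n, ℂ)` is closed:
if `ι : ℂˣ →* GL(n, ℂ)` is a group homomorphism each of whose matrix entries is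
holomorphic as a function on `ℂ ∖ {0}`, then the range of `ι` is a closed subset
of `GL(n, ℂ)`. -/
theorem range_of_holomorphic_hom_isClosed (n : ℕ) (hn : 0 < n)
    (ι : ℂˣ →* Matrix.GeneralLinearGroup (Fin n) ℂ)
    (hhol : ∀ i j : Fin n, ∃ g : ℂ → ℂ,
      (∀ (z : ℂ) (hz : z ≠ 0),
        g z = (ι (Units.mk0 z hz) : Matrix (Fin n) (Fin n) ℂ) i j) ∧
      (∀ z : ℂ, z ≠ 0 → DifferentiableAt ℂ g z)) :
    IsClosed (Set.range fun u : ℂˣ => ι u) := by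
  choose G hG hGd using hhol
  have hG' : ∀ (u : ℂˣ) i j, G i j u = (ι u : Matrix (Fin n) (Fin n) ℂ) i j := fun u i j => by
    rw [hG i j u u.ne_zero, Units.mk0_val]
  have hcont : Continuous fun u : ℂˣ => (ι u : Matrix (Fin n) (Fin n) ℂ) := by
    refine continuous_matrix fun i j => ?_
    simp only [← hG']
    exact continuous_iff_continuousAt.mpr fun u =>
      ContinuousAt.comp (f := Units.val) (hGd i j u u.ne_zero).continuousAt
        Units.continuous_val.continuousAt
  let e : ℂ → ℂˣ := fun t => Units.mk0 (Complex.exp t) (Complex.exp_ne_zero t)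
  have he0 : e 0 = 1 := Units.ext Complex.exp_zero
  have heper : e (2 * Real.pi * Complex.I) = 1 := Units.ext Complex.exp_two_pi_mul_I
  have headd : ∀ s t, e (s + t) = e s * e t := fun s t => Units.ext (Complex.exp_add s t)
  have hesurj : ∀ u : ℂˣ, ∃ t, e t = u := fun u =>
    ⟨Complex.log u, Units.ext (Complex.exp_log u.ne_zero)⟩
  rcases eq_one_or_exists_eigenvector_of_periodic
      (F := fun t => (ι (e t) : Matrix (Fin n) (Fin n) ℂ)) (by simp [he0])
      (fun s t => by simp [headd])
      (fun i j => by
        simp only [← hG']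
        exact DifferentiableAt.comp (g := G i j) (f := Complex.exp) (0 : ℂ)
          (hGd i j _ (Complex.exp_ne_zero 0)) Complex.differentiableAt_exp)
      (by simp [heper]) with htriv | ⟨k, hk, v, hv, hkv⟩
  · have : (Set.range fun u : ℂˣ => ι u) = {1} := by
      have h1 : ∀ u, ι u = 1 := fun u => by
        obtain ⟨t, rfl⟩ := hesurj u
        exact Units.ext (htriv t)
      simp [h1]
    rw [this]
    exact isClosed_singleton
  · have hkv' : ∀ u : ℂˣ, (ι u : Matrix (Fin n) (Fin n) ℂ) *ᵥ v = (u : ℂ) ^ k • v := fun u => by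
      obtain ⟨t, rfl⟩ := hesurj u
      exact hkv t
    refine isClosed_iff_ultrafilter.mpr fun g W hW hrange => ?_
    obtain ⟨U, rfl⟩ : ∃ U : Ultrafilter ℂˣ, U.map (fun u => ι u) = W :=
      ⟨_, Ultrafilter.ofComapInfPrincipal_eq_of_map (Set.image_univ ▸ hrange)⟩
    have hlim : Tendsto (fun u : ℂˣ => (ι u : Matrix (Fin n) (Fin n) ℂ)) U
        (𝓝 (g : Matrix (Fin n) (Fin n) ℂ)) :=
      (Units.continuous_val.tendsto g).comp hW
    obtain ⟨i, hi⟩ := Function.ne_iff.mp hv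
    have hi : v i ≠ 0 := hi
    have hlimv : Tendsto (fun u : ℂˣ => (u : ℂ) ^ k • v) U
        (𝓝 ((g : Matrix (Fin n) (Fin n) ℂ) *ᵥ v)) := by
      simp only [← hkv']
      exact ((continuous_id.matrix_mulVec continuous_const).tendsto _).comp hlim
    have hpow : Tendsto (fun u : ℂˣ => (u : ℂ) ^ k) U
        (𝓝 (((g : Matrix (Fin n) (Fin n) ℂ) *ᵥ v) i / v i)) := by
      refine ((tendsto_pi_nhds.mp hlimv i).div_const (v i)).congr fun u => ?_
      simp [hi]
    have hgv : (g : Matrix (Fin n) (Fin n) ℂ) *ᵥ v =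
        (((g : Matrix (Fin n) (Fin n) ℂ) *ᵥ v) i / v i) • v :=
      tendsto_nhds_unique hlimv (hpow.smul_const v)
    have hc : ((g : Matrix (Fin n) (Fin n) ℂ) *ᵥ v) i / v i ≠ 0 := by
      intro h
      rw [h, zero_smul] at hgv
      apply hv
      rw [← Matrix.one_mulVec v, ← Units.inv_mul g, ← Matrix.mulVec_mulVec, hgv,
        Matrix.mulVec_zero]
    obtain ⟨z, hz⟩ := exists_le_nhds_of_tendsto_zpow hk hc hpow
    exact ⟨z, Units.ext (tendsto_nhds_unique ((hcont.tendsto z).mono_left hz) hlim)⟩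
end
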